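/- arXiv:1904.01858 — 2 statements merged into one kernel-verified Lean document; each statement's English description precedes it below -/
import Mathlib

section
/- A finite group G is code-perfect if and only if G contains no element of order 4. -/
/-- The Cayley graph of a group `G` with connection set `S`: distinct vertices `x`, `y`
are adjacent iff `y * x⁻¹ ∈ S` (for inverse-closed `S` this relation is symmetric). -/
def cayley (G : Type*) [Group G] (S : Set G) : SimpleGraph G :=
  SimpleGraph.fromRel (fun x y => y * x⁻¹ ∈ S)

/-- `C` is a perfect code in the graph `Γ`: `C` is an independent set and every vertex
outside `C` is adjacent to exactly one vertex of `C`. -/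
def IsPerfectCode {V : Type*} (Γ : SimpleGraph V) (C : Set V) : Prop :=
  (∀ u ∈ C, ∀ v ∈ C, ¬ Γ.Adj u v) ∧ ∀ v ∉ C, ∃! u, u ∈ C ∧ Γ.Adj v u

/-- `C` is a perfect code of the group `G`: there is an inverse-closed `S ⊆ G` with
`1 ∉ S` such that `C` is a perfect code in `Cay(G, S)`. -/
def IsPerfectCodeOfGroup (G : Type*) [Group G] (C : Set G) : Prop :=
  ∃ S : Set G, S⁻¹ = S ∧ (1 : G) ∉ S ∧ IsPerfectCode (cayley G S) C

/-- A group is code-perfect if every subgroup is a perfect code of the group. -/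
def IsCodePerfect (G : Type*) [Group G] : Prop :=
  ∀ H : Subgroup G, IsPerfectCodeOfGroup G (H : Set G)

/-- `S` is an inverse-closed set meeting every left coset of `H` in at most one element. -/
def IsInvPartialTransversal {G : Type*} [Group G] (H : Subgroup G) (S : Set G) : Prop :=
  (∀ s ∈ S, s⁻¹ ∈ S) ∧ ∀ s ∈ S, ∀ t ∈ S, s⁻¹ * t ∈ H → s = t

/-- In a finite group without elements of order 4, if `s * s ∈ H` then the coset `s H` contains
an element equal to its own inverse. -/
theorem exists_self_inv_mem_leftCoset {G : Type*} [Group G] [Finite G]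
    (h4 : ∀ g : G, orderOf g ≠ 4) (H : Subgroup G) (s : G) (hs : s * s ∈ H) :
    ∃ t : G, t⁻¹ = t ∧ s⁻¹ * t ∈ H := by
  have hpos : orderOf s ≠ 0 := (orderOf_pos s).ne'
  have hnd : ¬ 4 ∣ orderOf s := fun hd => h4 _ (orderOf_pow_orderOf_div hpos hd)
  obtain ⟨j, hj⟩ : ∃ j, orderOf s ∣ 2 * (2 * j + 1) := by
    rcases Nat.even_or_odd' (orderOf s) with ⟨c, hc | hc⟩
    · rcases Nat.even_or_odd' c with ⟨d, hd | hd⟩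
      · exact absurd ⟨d, by omega⟩ hnd
      · exact ⟨d, by rw [hc, hd]⟩
    · exact ⟨c, by rw [hc]; exact dvd_mul_left _ _⟩
  refine ⟨s ^ (2 * j + 1), ?_, ?_⟩
  · rw [inv_eq_iff_mul_eq_one, ← pow_add, ← two_mul]
    exact orderOf_dvd_iff_pow_eq_one.1 hj
  · rw [pow_succ', inv_mul_cancel_left, pow_mul, pow_two]
    exact H.pow_mem hs j

theorem IsInvPartialTransversal.insert_pair {G : Type*} [Group G] {H : Subgroup G} {S : Set G}
    (hS : IsInvPartialTransversal H S) {s : G} (h1 : ∀ t ∈ S, t⁻¹ * s ∉ H)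
    (h2 : ∀ t ∈ S, t⁻¹ * s⁻¹ ∉ H) (h3 : s * s ∈ H → s⁻¹ = s) :
    IsInvPartialTransversal H (S ∪ {s, s⁻¹}) := by
  have key : ∀ a b : G, a⁻¹ * b ∈ H → b⁻¹ * a ∈ H := fun a b h => by
    simpa using H.inv_mem h
  refine ⟨?_, ?_⟩
  · rintro t (ht | rfl | rfl)
    · exact Or.inl (hS.1 t ht)
    · simp
    · simp
  · rintro a (ha | rfl | rfl) b (hb | rfl | rfl) hab
    · exact hS.2 a ha b hb hab
    · exact absurd hab (h1 a ha)
    · exact absurd hab (h2 a ha)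
    · exact absurd (key _ _ hab) (h1 b hb)
    · rfl
    · refine (h3 ?_).symm
      simpa using H.inv_mem hab
    · exact absurd (key _ _ hab) (h2 b hb)
    · exact h3 (by simpa using hab)
    · rfl

/-- If an inverse-closed partial transversal of the left cosets of `H` covers `H x⁻¹ H`, then it
covers `H x H`. -/
theorem IsInvPartialTransversal.covers_of_covers_inv {G : Type*} [Group G] [Finite G]
    {H : Subgroup G} {S : Set G} (hS : IsInvPartialTransversal H S) (x : G)
    (hcov : ∀ y ∈ DoubleCoset.doubleCoset x⁻¹ (H : Set G) H, ∃ s ∈ S, s⁻¹ * y ∈ H) :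
    ∃ s ∈ S, s⁻¹ * x ∈ H := by
  set D : G → Set G := fun z => DoubleCoset.doubleCoset z (H : Set G) H with hD
  have hmem : ∀ z y h, h ∈ H → y ∈ D z → y * h ∈ D z := by
    intro z y h hh hy
    obtain ⟨a, ha, b, hb, rfl⟩ := DoubleCoset.mem_doubleCoset.1 hy
    exact DoubleCoset.mem_doubleCoset.2 ⟨a, ha, b * h, H.mul_mem hb hh, by group⟩
  have hinv : ∀ z y, y ∈ D z → y⁻¹ ∈ D z⁻¹ := by
    intro z y hy
    obtain ⟨a, ha, b, hb, rfl⟩ := DoubleCoset.mem_doubleCoset.1 hy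
    exact DoubleCoset.mem_doubleCoset.2 ⟨b⁻¹, H.inv_mem hb, a⁻¹, H.inv_mem ha, by group⟩
  let invEquiv : ∀ T : Set G, (∀ s ∈ T, s⁻¹ ∈ T) → ((T ∩ D x : Set G) ≃ (T ∩ D x⁻¹ : Set G)) :=
    fun T hT =>
    { toFun := fun s => ⟨s.1⁻¹, hT _ s.2.1, hinv _ _ s.2.2⟩
      invFun := fun s => ⟨s.1⁻¹, hT _ s.2.1, by simpa using hinv _ _ s.2.2⟩
      left_inv := fun s => by simp
      right_inv := fun s => by simp }
  let f : ∀ z, (S ∩ D z : Set G) × H → (Set.univ ∩ D z : Set G) := fun z p =>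
    ⟨p.1.1 * p.2.1, trivial, hmem _ _ _ p.2.2 p.1.2.2⟩
  have hf : ∀ z, Function.Injective (f z) := by
    rintro z ⟨⟨s, hs⟩, ⟨h, hh⟩⟩ ⟨⟨t, ht⟩, ⟨k, hk⟩⟩ hst
    have hst : s * h = t * k := congrArg Subtype.val hst
    have h1 : s⁻¹ * t = h * k⁻¹ := by
      rw [inv_mul_eq_iff_eq_mul, ← mul_assoc, hst, mul_inv_cancel_right]
    obtain rfl := hS.2 s hs.1 t ht.1 (h1 ▸ H.mul_mem hh (H.inv_mem hk))
    obtain rfl := mul_left_cancel hst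
    rfl
  have hf' : Function.Surjective (f x⁻¹) := by
    rintro ⟨y, -, hy⟩
    obtain ⟨s, hs, hsy⟩ := hcov y hy
    have hsD : s ∈ D x⁻¹ := by simpa using hmem _ _ _ (H.inv_mem hsy) hy
    exact ⟨⟨⟨s, hs, hsD⟩, ⟨_, hsy⟩⟩, Subtype.ext (mul_inv_cancel_left _ _)⟩
  have hcard : Nat.card ((S ∩ D x : Set G) × H) = Nat.card (Set.univ ∩ D x : Set G) := by
    rw [Nat.card_congr (invEquiv Set.univ fun _ _ => trivial),
      ← Nat.card_congr (Equiv.ofBijective _ ⟨hf x⁻¹, hf'⟩)]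
    exact Nat.card_congr ((invEquiv S hS.1).prodCongr (Equiv.refl _))
  obtain ⟨⟨⟨s, hs⟩, ⟨h, hh⟩⟩, hsx⟩ := ((Nat.bijective_iff_injective_and_card _).2
    ⟨hf x, hcard⟩).2 ⟨x, trivial, DoubleCoset.mem_doubleCoset_self H H x⟩
  have hsx : s * h = x := congrArg Subtype.val hsx
  exact ⟨s, hs.1, by rw [← hsx, inv_mul_cancel_left]; exact hh⟩

theorem exists_inv_transversal {G : Type*} [Group G] [Finite G]
    (h4 : ∀ g : G, orderOf g ≠ 4) (H : Subgroup G) :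
    ∃ S : Set G, IsInvPartialTransversal H S ∧ ∀ x, ∃ s ∈ S, s⁻¹ * x ∈ H := by
  obtain ⟨S, hS⟩ := (Set.toFinite {S : Set G | IsInvPartialTransversal H S}).exists_maximal
    ⟨∅, by simp [IsInvPartialTransversal]⟩
  have hmax : ∀ s : G, (∀ t ∈ S, t⁻¹ * s ∉ H) → (∀ t ∈ S, t⁻¹ * s⁻¹ ∉ H) →
      ¬ (s * s ∈ H → s⁻¹ = s) := by
    intro s h1 h2 h3
    have hs : s ∈ S := hS.2 (hS.1.insert_pair h1 h2 h3) Set.subset_union_left (by simp)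
    exact h1 s hs (by simp)
  refine ⟨S, hS.1, fun x => ?_⟩
  by_contra! hx
  have hcos : ∀ y z : G, y⁻¹ * z ∈ H → (∀ t ∈ S, t⁻¹ * y ∉ H) → ∀ t ∈ S, t⁻¹ * z ∉ H := by
    intro y z hyz hy t ht htz
    exact hy t ht (by simpa [mul_assoc] using H.mul_mem htz (H.inv_mem hyz))
  obtain ⟨y, hy, hyS⟩ : ∃ y ∈ DoubleCoset.doubleCoset x⁻¹ (H : Set G) H,
      ∀ t ∈ S, t⁻¹ * y ∉ H := by
    by_contra! hcov
    obtain ⟨s, hs, hsx⟩ := hS.1.covers_of_covers_inv x hcov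
    exact hx s hs hsx
  obtain ⟨h, hh, k, hk, rfl⟩ := DoubleCoset.mem_doubleCoset.1 hy
  have h1 : ∀ t ∈ S, t⁻¹ * (x * h⁻¹) ∉ H := hcos x _ (by simpa using hh) hx
  have h2 : ∀ t ∈ S, t⁻¹ * (x * h⁻¹)⁻¹ ∉ H := hcos _ _ (by simpa [mul_assoc] using hk) hyS
  by_cases hsq : x * h⁻¹ * (x * h⁻¹) ∈ H
  · obtain ⟨t, ht, hst⟩ := exists_self_inv_mem_leftCoset h4 H _ hsq
    have h3 := hcos _ _ hst h1
    exact hmax t h3 (by rwa [ht]) fun _ => ht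
  · exact hmax _ h1 h2 fun h => absurd h hsq

theorem cayley_adj_iff {G : Type*} [Group G] {S : Set G} (hS : S⁻¹ = S) (h1 : (1 : G) ∉ S)
    (x y : G) : (cayley G S).Adj x y ↔ x * y⁻¹ ∈ S := by
  have hxy : y * x⁻¹ ∈ S ↔ x * y⁻¹ ∈ S := by
    conv_lhs => rw [← hS]
    simp
  simp only [cayley, SimpleGraph.fromRel_adj, hxy, or_self, and_iff_right_iff_imp]
  rintro h rfl
  exact h1 (by simpa using h)

/-- A finite group is code-perfect iff it has no elements of order 4. -/
theorem code_perfect_iff_no_order_four (G : Type*) [Group G] [Fintype G] :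
    IsCodePerfect G ↔ ∀ g : G, orderOf g ≠ 4 := by
  constructor
  · intro hG g hg
    have hg4 : g ^ 4 = 1 := hg ▸ pow_orderOf_eq_one g
    have hg2 : g ^ 2 ≠ 1 := fun h => by
      have := Nat.le_of_dvd two_pos (orderOf_dvd_of_pow_eq_one h)
      omega
    have hmem : ∀ u ∈ Subgroup.zpowers (g ^ 2), u = 1 ∨ u = g ^ 2 := by
      rintro u ⟨n, rfl⟩
      rcases Int.even_or_odd' n with ⟨k, rfl | rfl⟩
      · left
        simp only [zpow_mul]
        rw [zpow_ofNat, ← pow_mul, hg4, one_zpow]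
      · right
        simp only [zpow_add, zpow_mul]
        rw [zpow_ofNat, ← pow_mul, hg4, one_zpow, one_mul, zpow_one]
    have hgH : g ∉ Subgroup.zpowers (g ^ 2) := fun h => by
      rcases hmem g h with h | h
      · exact hg2 (by rw [h, one_pow])
      · have h1 : g = 1 := by simpa [pow_two] using h
        exact hg2 (by rw [h1, one_pow])
    obtain ⟨S, hS, h1, -, hcode⟩ := hG (Subgroup.zpowers (g ^ 2))
    simp only [cayley_adj_iff hS h1] at hcode
    obtain ⟨u, ⟨hu, huS⟩, huniq⟩ := hcode g hgH
    have hinv : g * (g ^ 2 * u)⁻¹ ∈ S := by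
      rw [← hS, Set.mem_inv]
      rcases hmem u hu with rfl | rfl
      · convert huS using 1
        group
      · convert huS using 1
        rw [← pow_add, hg4]
        group
    have := huniq (g ^ 2 * u) ⟨mul_mem (Subgroup.mem_zpowers _) hu, hinv⟩
    exact hg2 (by simpa using this)
  · intro h4 H
    obtain ⟨S, ⟨hinv, huniq⟩, hcov⟩ := exists_inv_transversal h4 H
    have hS : (S \ (H : Set G))⁻¹ = S \ (H : Set G) := by
      ext s
      simp only [Set.mem_inv, Set.mem_sdiff, SetLike.mem_coe, inv_mem_iff]
      exact and_congr_left' ⟨fun h => by simpa using hinv _ h, hinv s⟩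
    have h1 : (1 : G) ∉ S \ (H : Set G) := fun h => h.2 H.one_mem
    refine ⟨S \ (H : Set G), hS, h1, ?_⟩
    simp only [IsPerfectCode, cayley_adj_iff hS h1]
    refine ⟨fun u hu v hv h => h.2 (H.mul_mem hu (H.inv_mem hv)), fun v hv => ?_⟩
    obtain ⟨s, hs, hsv⟩ := hcov v
    refine ⟨s⁻¹ * v, ⟨hsv, ?_, ?_⟩, ?_⟩
    · simpa using hs
    · intro h
      exact hv (by simpa using H.mul_mem h hsv)
    · rintro u ⟨hu, huS, -⟩
      have := huniq s hs _ huS (by simpa [mul_assoc] using H.mul_mem hsv (H.inv_mem hu))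
      rw [this]
      group
end

section
/- Every finite group of odd order is code-perfect; that is, if G is a finite group of odd order, then every subgroup of G is a perfect code of G. -/
/-- In a finite group, the representatives of the left cosets of `H` can be chosen so that their
inverses represent all left cosets as well. -/
theorem Subgroup.exists_bijective_mk_inv_eq {G : Type*} [Group G] [Finite G] (H : Subgroup G) :
    ∃ (f : G ⧸ H → G ⧸ H) (t : G ⧸ H → G), Function.Bijective f ∧
      (∀ p, (t p : G ⧸ H) = f p) ∧ ∀ p, ((t p)⁻¹ : G) = p := by
  classical
  have := Fintype.ofFinite (G ⧸ H)
  obtain ⟨f, hf, hr⟩ := (Fintype.all_card_le_filter_rel_iff_exists_injective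
    (fun p q : G ⧸ H => ∃ t : G, (t : G ⧸ H) = q ∧ ((t⁻¹ : G) : G ⧸ H) = p)).1 (by
      intro A
      set N : Finset (G ⧸ H) := {q | ∃ p ∈ A, ∃ t : G, (t : G ⧸ H) = q ∧ ((t⁻¹ : G) : G ⧸ H) = p}
      have h : Nat.card (QuotientGroup.mk ⁻¹' (A : Set (G ⧸ H)) : Set G) ≤
          Nat.card (QuotientGroup.mk ⁻¹' (N : Set (G ⧸ H)) : Set G) := by
        refine Nat.card_le_card_of_injective (fun x => ⟨x.1⁻¹, ?_⟩) ?_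
        · exact Finset.mem_filter.2 ⟨Finset.mem_univ _, _, x.2, x.1⁻¹, rfl, by rw [inv_inv]⟩
        · intro x y hxy
          simpa [Subtype.ext_iff] using hxy
      rw [QuotientGroup.card_preimage_mk, QuotientGroup.card_preimage_mk] at h
      simpa using Nat.le_of_mul_le_mul_left h Nat.card_pos)
  choose t ht using hr
  exact ⟨f, t, Finite.injective_iff_bijective.1 hf, fun p => (ht p).1, fun p => (ht p).2⟩

/-- In a finite group of odd order, `H` is the only double coset of `H` that is stable under
inversion. -/
theorem Subgroup.mem_of_mk_inv_mem_orbit {G : Type*} [Group G] [Finite G]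
    (hodd : Odd (Nat.card G)) (H : Subgroup G) {v : G}
    (hv : ((v⁻¹ : G) : G ⧸ H) ∈ MulAction.orbit H (v : G ⧸ H)) : v ∈ H := by
  classical
  have := Fintype.ofFinite G
  set D : Set G := QuotientGroup.mk ⁻¹' (MulAction.orbit H (v : G ⧸ H)) with hD
  have mem_D (x : G) : x ∈ D ↔ ∃ h ∈ H, ∃ k ∈ H, x = h * v * k := by
    simp only [hD, Set.mem_preimage, MulAction.mem_orbit_iff, Subtype.exists]
    constructor
    · rintro ⟨h, hh, hx⟩
      have hx' : ((h * v : G) : G ⧸ H) = x := hx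
      exact ⟨h, hh, _, QuotientGroup.eq.1 hx', by group⟩
    · rintro ⟨h, hh, k, hk, rfl⟩
      exact ⟨h, hh, QuotientGroup.eq.2 (by simpa [mul_assoc] using hk)⟩
  obtain ⟨a, ha, b, hb, hab⟩ := (mem_D v⁻¹).1 hv
  have inv_D : ∀ x ∈ D, x⁻¹ ∈ D := by
    intro x hx
    obtain ⟨h, hh, k, hk, rfl⟩ := (mem_D x).1 hx
    refine (mem_D _).2 ⟨k⁻¹ * a, H.mul_mem (H.inv_mem hk) ha, b * h⁻¹,
      H.mul_mem hb (H.inv_mem hh), ?_⟩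
    rw [mul_inv_rev, mul_inv_rev, hab]
    group
  have card_D : Odd (Nat.card D) := by
    rw [QuotientGroup.card_preimage_mk]
    have hH : Odd (Nat.card H) := hodd.of_dvd_nat H.card_subgroup_dvd_card
    refine hH.mul (hH.of_dvd_nat ?_)
    rw [← Nat.card_congr (MulAction.orbitProdStabilizerEquivGroup H (v : G ⧸ H)), Nat.card_prod]
    exact Dvd.intro _ rfl
  have h2 : ¬ 2 ∣ Fintype.card D := by
    rw [← Nat.card_eq_fintype_card]
    exact card_D.not_two_dvd_nat
  let σ : Equiv.Perm D := Function.Involutive.toPerm (fun x => ⟨x.1⁻¹, inv_D _ x.2⟩)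
    (fun x => by simp)
  obtain ⟨x, hx⟩ := Equiv.Perm.exists_fixed_point_of_prime (p := 2) (n := 1) h2 (σ := σ)
    (by ext x; exact inv_inv (x : G))
  have hx1 : (x : G)⁻¹ = x := congrArg Subtype.val hx
  have hx2 : (x : G) ^ 2 = 1 := by
    rw [sq]
    nth_rewrite 1 [← hx1]
    simp
  have hx3 : (x : G) = 1 := by
    have hcop : (Nat.card G).Coprime 2 := hodd.coprime_two_right
    exact (powCoprime hcop).injective (by simpa using hx2)
  obtain ⟨h, hh, k, hk, hxk⟩ := (mem_D x).1 x.2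
  rw [hx3] at hxk
  have : v = h⁻¹ * k⁻¹ := by
    rw [← mul_one h⁻¹, hxk]
    group
  rw [this]
  exact H.mul_mem (H.inv_mem hh) (H.inv_mem hk)

/-- A subgroup `H` is a perfect code if some inverse-closed set disjoint from `H` meets every
nontrivial left coset of `H` in exactly one element. -/
theorem Subgroup.isPerfectCodeOfGroup_of_existsUnique {G : Type*} [Group G] (H : Subgroup G)
    (S : Set G) (hinv : ∀ x ∈ S, x⁻¹ ∈ S) (hdisj : ∀ x ∈ S, x ∉ H)
    (huniq : ∀ v ∉ H, ∃! x, x ∈ S ∧ (x : G ⧸ H) = v) : IsPerfectCodeOfGroup G (H : Set G) := by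
  refine ⟨S, ?_, fun h => hdisj 1 h H.one_mem, ?_, ?_⟩
  · ext x
    exact ⟨fun hx => by simpa using hinv _ hx, hinv x⟩
  · rintro u hu v hv ⟨-, h | h⟩
    · exact hdisj _ h (H.mul_mem hv (H.inv_mem hu))
    · exact hdisj _ h (H.mul_mem hu (H.inv_mem hv))
  · intro v hv
    obtain ⟨x, ⟨hxS, hxv⟩, hx⟩ := huniq v hv
    refine ⟨x⁻¹ * v, ⟨QuotientGroup.eq.1 hxv, ?_, Or.inr ?_⟩, ?_⟩
    · intro h
      exact hv (h ▸ QuotientGroup.eq.1 hxv)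
    · simpa using hxS
    · rintro u ⟨hu, -, h⟩
      have hS : v * u⁻¹ ∈ S := by
        rcases h with h | h
        · simpa using hinv _ h
        · exact h
      rw [← hx (v * u⁻¹) ⟨hS, QuotientGroup.eq.2 (by simpa using hu)⟩]
      group

/-- Every finite group of odd order is code-perfect. -/
theorem odd_order_code_perfect (G : Type*) [Group G] [Fintype G]
    (hodd : Odd (Fintype.card G)) :
    IsCodePerfect G := by
  intro H
  obtain ⟨f, t, hf, htf, hti⟩ := H.exists_bijective_mk_inv_eq
  obtain ⟨key, hkey⟩ : ∃ key : G ⧸ H → ℕ, ∀ p q, key p = key q ↔ p ∈ MulAction.orbit H q := by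
    obtain ⟨n, ⟨e⟩⟩ := Finite.exists_equiv_fin (MulAction.orbitRel.Quotient H (G ⧸ H))
    refine ⟨fun p => e (Quotient.mk _ p), fun p q => ?_⟩
    rw [Fin.val_inj, e.apply_eq_iff_eq, Quotient.eq]
    rfl
  have key_congr {x y : G} (h : (x : G ⧸ H) = y) :
      key (x : G ⧸ H) = key y ∧ key (x⁻¹ : G) = key (y⁻¹ : G) := by
    refine ⟨by rw [h], (hkey _ _).2 ⟨⟨x⁻¹ * y, QuotientGroup.eq.1 h⟩, ?_⟩⟩
    change ((x⁻¹ * y * y⁻¹ : G) : G ⧸ H) = _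
    simp
  have key_ne {v : G} (hv : v ∉ H) : key (v⁻¹ : G) ≠ key (v : G ⧸ H) := fun h =>
    hv (H.mem_of_mk_inv_mem_orbit (by rwa [Nat.card_eq_fintype_card]) ((hkey _ _).1 h))
  have key_eq {v : G} (hv : v ∈ H) : key (v⁻¹ : G) = key (v : G ⧸ H) := by
    rw [QuotientGroup.eq.2 (show (v⁻¹)⁻¹ * v ∈ H by simpa using H.mul_mem hv hv)]
  let T : Set G := {x | x ∈ Set.range t ∧ key (x : G ⧸ H) < key (x⁻¹ : G)}
  refine H.isPerfectCodeOfGroup_of_existsUnique {x | x ∈ T ∨ x⁻¹ ∈ T} ?_ ?_ ?_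
  · rintro x (h | h)
    · exact Or.inr (by simpa using h)
    · exact Or.inl h
  · rintro x (⟨-, h⟩ | ⟨-, h⟩) hx
    · exact h.ne' (key_eq hx)
    · exact h.ne' (key_eq (H.inv_mem hx))
  · intro v hv
    rcases (key_ne hv).lt_or_gt with h | h
    · refine ⟨(t v)⁻¹, ⟨Or.inr ⟨⟨v, by simp⟩, ?_⟩, hti v⟩, ?_⟩
      · obtain ⟨h1, h2⟩ := key_congr (hti v)
        rwa [inv_inv (t v)⁻¹, h1, h2]
      · rintro x ⟨⟨-, hx⟩ | ⟨⟨p, hp⟩, -⟩, hxv⟩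
        · obtain ⟨h1, h2⟩ := key_congr hxv
          omega
        · have := hti p
          rw [hp, inv_inv, hxv] at this
          rw [this, hp, inv_inv]
    · obtain ⟨p, hp⟩ := hf.2 (v : G ⧸ H)
      have htp : (t p : G ⧸ H) = v := (htf p).trans hp
      refine ⟨t p, ⟨Or.inl ⟨⟨p, rfl⟩, ?_⟩, htp⟩, ?_⟩
      · obtain ⟨h1, h2⟩ := key_congr htp
        rwa [h1, h2]
      · rintro x ⟨⟨⟨q, rfl⟩, -⟩ | ⟨-, hx⟩, hxv⟩
        · rw [hf.1 ((htf q).symm.trans (hxv.trans hp.symm))]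
        · obtain ⟨h1, h2⟩ := key_congr hxv
          rw [inv_inv] at hx
          omega
end
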